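/- Let n_i, n_j be positive real numbers, p = n_i/(n_i+n_j), α a real number with α ≥ 0, and λ_x ∈ [0,1]. Define R(λ) = (λ - 1/2)² - (λ - p)², f(λ) = (λ - λ_x)²/2 + α·R(λ), and λ_y = clamp(λ_x - α·(n_i - n_j)/(n_i + n_j), 0, 1). Then λ_y is the unique minimizer of f over [0,1]: for every λ ∈ [0,1] with λ ≠ λ_y, f(λ_y) < f(λ). -/

import Mathlib

/-- The variational inequality characterizing the clamp of `m` as its projection onto `[0,1]`. -/
theorem clamp_variational_inequality (m : ℝ) {l : ℝ} (hl : l ∈ Set.Icc (0 : ℝ) 1) :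
    0 ≤ (l - min (max m 0) 1) * (min (max m 0) 1 - m) := by
  obtain ⟨hl0, hl1⟩ := hl
  rcases le_total m 0 with h0 | h0
  · rw [max_eq_right h0, min_eq_left zero_le_one]
    exact mul_nonneg (by linarith) (by linarith)
  · rw [max_eq_left h0]
    rcases le_total m 1 with h1 | h1
    · simp [min_eq_left h1]
    · rw [min_eq_right h1]
      exact mul_nonneg_of_nonpos_of_nonpos (by linarith) (by linarith)


/-- The label-shift weight `λ_y = clamp(λ_x - α·(n_i - n_j)/(n_i + n_j), 0, 1)` is
the *unique* minimizer over `[0,1]` of the balance-regularized objective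
`f(λ) = (λ - λ_x)²/2 + α·R(λ)` with `R(λ) = (λ - 1/2)² - (λ - p)²`,
`p = n_i/(n_i + n_j)`. -/
theorem stmt_1 (ni nj : ℝ) (hni : 0 < ni) (hnj : 0 < nj)
    (α : ℝ) (hα : 0 ≤ α) (lx : ℝ) (hlx : lx ∈ Set.Icc (0 : ℝ) 1) :
    let p : ℝ := ni / (ni + nj)
    let R : ℝ → ℝ := fun l => (l - 1/2)^2 - (l - p)^2
    let f : ℝ → ℝ := fun l => (l - lx)^2 / 2 + α * R l
    let ly : ℝ := min (max (lx - α * (ni - nj) / (ni + nj)) 0) 1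
    ∀ l ∈ Set.Icc (0 : ℝ) 1, l ≠ ly → f ly < f l := by
  intro p R f ly l hl hne
  have hm : α * (ni - nj) / (ni + nj) = α * (2 * p - 1) := by
    have hsum : ni + nj ≠ 0 := (add_pos hni hnj).ne'
    simp only [p]
    field_simp
    ring
  have hvar : 0 ≤ (l - ly) * (ly - (lx - α * (2 * p - 1))) := by
    rw [← hm]
    exact clamp_variational_inequality _ hl
  have hsq : 0 < (l - ly) ^ 2 := sq_pos_of_ne_zero (sub_ne_zero.mpr hne)
  have hdiff : f l - f ly =
      (l - ly) ^ 2 / 2 + (l - ly) * (ly - (lx - α * (2 * p - 1))) := by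
    simp only [f, R]
    ring
  linarith
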